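/- (Induction step in the proof of Theorem 2.) Fix 0 ≤ t < T and suppose that for every measurable g : X^{t+1} → ℝ making all integrals below finite, V_t(g) = ∫_X (π̄_t^t(x₀))² / q₀(x₀) · ( G₀(x₀) − m_g )² dλ(x₀) + Σ_{k=1}^{t} ∫_{X^{k+1}} (π̄_t^t(x_{0:k}))² / ( q_k(x_{0:k−1}, x_k) · π_k^{k−1}(x_{0:k−1}) ) · ( G_k(x_{0:k}) − m_g )² dλ^{⊗(k+1)}, where m_g := E_{π_t^t} g and G_k is the conditional expectation of g given x_{0:k} under π_t^t. Then for every measurable f : X^{t+2} → ℝ making all integrals below finite, the recursion yields V_{t+1}(f) = ∫_X (π̄_{t+1}^{t+1}(x₀))² / q₀(x₀) · ( F₀(x₀) − m )² dλ(x₀) + Σ_{k=1}^{t+1} ∫_{X^{k+1}} (π̄_{t+1}^{t+1}(x_{0:k}))² / ( q_k(x_{0:k−1}, x_k) · π_k^{k−1}(x_{0:k−1}) ) · ( F_k(x_{0:k}) − m )² dλ^{⊗(k+1)}, where m := E_{π_{t+1}^{t+1}} f and F_k is the conditional expectation of f given x_{0:k} under π_{t+1}^{t+1} (with F_{t+1}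 := f). -/

import Mathlib

open MeasureTheory Finset

noncomputable section

/-- The data of a state-space model with a (possibly time-varying) sequence of parameter
values: for each parameter index `k`, an initial density `mu0 k`, a transition density
`m k`, observation likelihoods `g k j` (time `j`), together with proposal densities
`q j` and a reference σ-finite measure `lam`. -/
structure SSData (Xs : Type) [MeasurableSpace Xs] where
  lam : Measure Xs
  mu0 : ℕ → Xs → ℝ
  m : ℕ → Xs → Xs → ℝ
  g : ℕ → ℕ → Xs → ℝ
  q : (j : ℕ) → (Fin j → Xs) → Xs → ℝ

/-- Variance of `h` under the probability density `d` relative to the base measure `ms`. -/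
def Vard {α : Type*} [MeasurableSpace α] (ms : Measure α) (d h : α → ℝ) : ℝ :=
  (∫ x, d x * (h x) ^ 2 ∂ms) - (∫ x, d x * h x ∂ms) ^ 2

namespace SSData

variable {Xs : Type} [MeasurableSpace Xs]

/-- Product reference measure on trajectories of length `n`. -/
def pim (D : SSData Xs) (n : ℕ) : Measure (Fin n → Xs) := Measure.pi fun _ => D.lam

/-- Unnormalized joint density `γ_k^s(x_{0:s})` at parameter index `k` and time `s`. -/
def gam (D : SSData Xs) (k s : ℕ) (x : Fin (s + 1) → Xs) : ℝ :=
  D.mu0 k (x 0) * D.g k 0 (x 0) *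
    ∏ i : Fin s, D.m k (x i.castSucc) (x i.succ) * D.g k ((i : ℕ) + 1) (x i.succ)

/-- Normalizing constant `Z_k^s`. -/
def Z (D : SSData Xs) (k s : ℕ) : ℝ := ∫ x, D.gam k s x ∂(D.pim (s + 1))

/-- Posterior density `π_k^s = γ_k^s / Z_k^s`. -/
def post (D : SSData Xs) (k s : ℕ) (x : Fin (s + 1) → Xs) : ℝ := D.gam k s x / D.Z k s

/-- Retargeting weight `a_t^{t+1} = γ_{t+1}^t / γ_t^t`. -/
def aw (D : SSData Xs) (t : ℕ) (x : Fin (t + 1) → Xs) : ℝ :=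
  D.gam (t + 1) t x / D.gam t t x

/-- Normalized one-step weight: `v₀ = π₀⁰/q₀` and
`v_k = π_k^k / (q_k(x_{0:k-1}, x_k) · π_k^{k-1}(x_{0:k-1}))` for `k ≥ 1`. -/
def vw (D : SSData Xs) : (k : ℕ) → (Fin (k + 1) → Xs) → ℝ
  | 0, x => D.post 0 0 x / D.q 0 (Fin.init x) (x 0)
  | (k + 1), x => D.post (k + 1) (k + 1) x /
      (D.q (k + 1) (Fin.init x) (x (Fin.last (k + 1))) * D.post (k + 1) k (Fin.init x))

/-- Expectation `E_{π_t^t} f`. -/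
def Epost (D : SSData Xs) (t : ℕ) (f : (Fin (t + 1) → Xs) → ℝ) : ℝ :=
  ∫ x, f x * D.post t t x ∂(D.pim (t + 1))

/-- `Ṽ₀(f) = Var_{q₀}(f)`. -/
def Vtilde0 (D : SSData Xs) (f : (Fin 1 → Xs) → ℝ) : ℝ :=
  Vard D.lam (fun y => D.q 0 (fun i => i.elim0) y) (fun y => f (fun _ => y))

/-- One recursion step
`Ṽ_{t+1}(f) = V̂_t( x_{0:t} ↦ ∫ q_{t+1}(x_{0:t},y) f(x_{0:t},y) dλ(y) )
  + ∫ π_{t+1}^t(x_{0:t}) Var_{q_{t+1}(x_{0:t},·)}(f(x_{0:t},·)) dλ^{⊗(t+1)}`,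
expressed given the previous-level functional `Vh = V̂_t`. -/
def VtildeStep (D : SSData Xs) (t : ℕ) (Vh : ((Fin (t + 1) → Xs) → ℝ) → ℝ)
    (f : (Fin (t + 2) → Xs) → ℝ) : ℝ :=
  Vh (fun xs => ∫ y, D.q (t + 1) xs y * f (Fin.snoc xs y) ∂D.lam) +
    ∫ xs, D.post (t + 1) t xs *
      Vard D.lam (fun y => D.q (t + 1) xs y) (fun y => f (Fin.snoc xs y)) ∂(D.pim (t + 1))

/-- The functional `V̂_t(f) = V̄_t(f) + Var_{π_{t+1}^t}(f)`, where
`V̄_t(f) = (Z_t^t/Z_{t+1}^t)² · V_t(a_t^{t+1}·f)` and `V_t(h) = Ṽ_t(v_t·(h − E_{π_t^t} h))`,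
defined by recursion on `t`. -/
def Vhat (D : SSData Xs) : (t : ℕ) → ((Fin (t + 1) → Xs) → ℝ) → ℝ
  | 0 => fun f =>
      (D.Z 0 0 / D.Z 1 0) ^ 2 *
        D.Vtilde0 (fun x => D.vw 0 x *
          (D.aw 0 x * f x - D.Epost 0 (fun y => D.aw 0 y * f y))) +
      Vard (D.pim 1) (D.post 1 0) f
  | (t + 1) => fun f =>
      (D.Z (t + 1) (t + 1) / D.Z (t + 2) (t + 1)) ^ 2 *
        D.VtildeStep t (D.Vhat t) (fun x => D.vw (t + 1) x *
          (D.aw (t + 1) x * f x - D.Epost (t + 1) (fun y => D.aw (t + 1) y * f y))) +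
      Vard (D.pim (t + 2)) (D.post (t + 2) (t + 1)) f

/-- The asymptotic variance functional `V_t(f) = Ṽ_t(v_t·(f − E_{π_t^t} f))` of the
semi-online particle estimator with time-varying parameters. -/
def V (D : SSData Xs) : (t : ℕ) → ((Fin (t + 1) → Xs) → ℝ) → ℝ
  | 0, f => D.Vtilde0 (fun x => D.vw 0 x * (f x - D.Epost 0 f))
  | (t + 1), f => D.VtildeStep t (D.Vhat t) (fun x => D.vw (t + 1) x * (f x - D.Epost (t + 1) f))

/-- Marginal `π̄_t^t(x_{0:k})` of the posterior `π_t^t` over the coordinates `x_{k+1:t}`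
(junk value `0` when `k > t`). -/
def marg (D : SSData Xs) (t k : ℕ) (x : Fin (k + 1) → Xs) : ℝ :=
  if h : k ≤ t then
    ∫ y : Fin (t - k) → Xs,
      D.post t t (fun i => Fin.append x y (Fin.cast (by omega) i)) ∂(D.pim (t - k))
  else 0

/-- Conditional expectation `F_k(x_{0:k}) = ∫ f(x_{0:t}) π_t^t(x_{0:t}) / π̄_t^t(x_{0:k})
dλ^{⊗(t-k)}(x_{k+1:t})` of `f` given `x_{0:k}` under `π_t^t` (junk value `0` when `k > t`). -/
def condExpF (D : SSData Xs) (t k : ℕ) (f : (Fin (t + 1) → Xs) → ℝ)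
    (x : Fin (k + 1) → Xs) : ℝ :=
  if h : k ≤ t then
    ∫ y : Fin (t - k) → Xs,
      f (fun i => Fin.append x y (Fin.cast (by omega) i)) *
        D.post t t (fun i => Fin.append x y (Fin.cast (by omega) i)) / D.marg t k x
      ∂(D.pim (t - k))
  else 0

end SSData


namespace SSData

variable {Xs : Type} [MeasurableSpace Xs]

theorem aux_prod {α β γ : Type*} [MeasurableSpace α] [MeasurableSpace β] [MeasurableSpace γ]
    {μ : Measure α} {ν : Measure β} {ρ : Measure γ} [SFinite μ] [SFinite ν]
    {S : α × β → γ} (hS : MeasurePreserving S (μ.prod ν) ρ) {φ : γ → ℝ} (hφ : Integrable φ ρ) :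
    (∀ᵐ x ∂μ, Integrable (fun y => φ (S (x, y))) ν) ∧
    Integrable (fun x => ∫ y, φ (S (x, y)) ∂ν) μ ∧
    ∫ x, ∫ y, φ (S (x, y)) ∂ν ∂μ = ∫ z, φ z ∂ρ := by
  have h1 : Integrable (fun p => φ (S p)) (μ.prod ν) := hS.integrable_comp_of_integrable hφ
  refine ⟨h1.prod_right_ae, h1.integral_prod_left, ?_⟩
  rw [← integral_prod (fun p => φ (S p)) h1, ← hS.map_eq,
    integral_map hS.measurable.aemeasurable]
  rw [hS.map_eq]; exact hφ.1

instance (D : SSData Xs) [SigmaFinite D.lam] (n : ℕ) : SigmaFinite (D.pim n) := by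
  unfold pim; infer_instance

theorem mp_append (D : SSData Xs) [SigmaFinite D.lam] {N a b : ℕ} (h : N = a + b) :
    MeasurePreserving (fun p : (Fin a → Xs) × (Fin b → Xs) =>
      (fun i : Fin N => Fin.append p.1 p.2 (Fin.cast h i)))
      ((D.pim a).prod (D.pim b)) (D.pim N) := by
  subst h
  have hm : Measurable (fun p : (Fin a → Xs) × (Fin b → Xs) =>
      (fun i : Fin (a + b) => Fin.append p.1 p.2 (Fin.cast rfl i))) := by
    rw [measurable_pi_iff]
    intro i
    induction i using Fin.addCases with
    | left i => simpa [Function.comp_def] using (measurable_pi_apply i).comp measurable_fst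
    | right i => simpa [Function.comp_def] using (measurable_pi_apply i).comp measurable_snd
  refine ⟨hm, (Measure.pi_eq fun s hs => ?_).symm⟩
  rw [Measure.map_apply hm (MeasurableSet.univ_pi hs)]
  have : (fun p : (Fin a → Xs) × (Fin b → Xs) =>
      (fun i : Fin (a + b) => Fin.append p.1 p.2 (Fin.cast rfl i))) ⁻¹' (Set.univ.pi s) =
      (Set.univ.pi fun i => s (Fin.castAdd b i)) ×ˢ (Set.univ.pi fun i => s (Fin.natAdd a i)) := by
    ext p
    simp only [Set.mem_preimage, Set.mem_pi, Set.mem_univ, true_imp_iff, Set.mem_prod]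
    constructor
    · intro h
      exact ⟨fun i => by simpa using h (Fin.castAdd b i), fun i => by simpa using h (Fin.natAdd a i)⟩
    · rintro ⟨h1, h2⟩ i
      induction i using Fin.addCases with
      | left i => simpa using h1 i
      | right i => simpa using h2 i
  rw [this, Measure.prod_prod, pim, pim, Measure.pi_pi, Measure.pi_pi, Fin.prod_univ_add]

theorem mp_snoc (D : SSData Xs) [SigmaFinite D.lam] (n : ℕ) :
    MeasurePreserving (fun p : (Fin n → Xs) × Xs => (Fin.snoc p.1 p.2 : Fin (n + 1) → Xs))
      ((D.pim n).prod D.lam) (D.pim (n + 1)) := by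
  have hm : Measurable (fun p : (Fin n → Xs) × Xs => (Fin.snoc p.1 p.2 : Fin (n + 1) → Xs)) := by
    rw [measurable_pi_iff]
    intro i
    induction i using Fin.lastCases with
    | last => simpa using measurable_snd
    | cast i => simpa [Function.comp_def] using (measurable_pi_apply i).comp measurable_fst
  refine ⟨hm, (Measure.pi_eq fun s hs => ?_).symm⟩
  rw [Measure.map_apply hm (MeasurableSet.univ_pi hs)]
  have : (fun p : (Fin n → Xs) × Xs => (Fin.snoc p.1 p.2 : Fin (n + 1) → Xs)) ⁻¹'
      (Set.univ.pi s) = (Set.univ.pi fun i : Fin n => s i.castSucc) ×ˢ (s (Fin.last n)) := by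
    ext p
    simp only [Set.mem_preimage, Set.mem_pi, Set.mem_univ, true_imp_iff, Set.mem_prod]
    constructor
    · intro h
      exact ⟨fun i => by simpa using h i.castSucc, by simpa using h (Fin.last n)⟩
    · rintro ⟨h1, h2⟩ i
      induction i using Fin.lastCases with
      | last => simpa using h2
      | cast i => simpa using h1 i
  rw [this, Measure.prod_prod, pim, Measure.pi_pi, Fin.prod_univ_castSucc]

/-- Integrating out the last `b` coordinates. -/
def Jg (D : SSData Xs) {N a b : ℕ} (h : N = a + b) (φ : (Fin N → Xs) → ℝ) (x : Fin a → Xs) : ℝ :=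
  ∫ y : Fin b → Xs, φ (fun i => Fin.append x y (Fin.cast h i)) ∂(D.pim b)

/-- Integrating out the last coordinate. -/
def Sg (D : SSData Xs) {n : ℕ} (φ : (Fin (n + 1) → Xs) → ℝ) (x : Fin n → Xs) : ℝ :=
  ∫ y, φ (Fin.snoc x y) ∂D.lam

theorem Jg_ae (D : SSData Xs) [SigmaFinite D.lam] {N a b : ℕ} (h : N = a + b)
    {φ : (Fin N → Xs) → ℝ} (hφ : Integrable φ (D.pim N)) :
    ∀ᵐ x ∂(D.pim a), Integrable
      (fun y : Fin b → Xs => φ (fun i => Fin.append x y (Fin.cast h i))) (D.pim b) :=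
  (aux_prod (D.mp_append h) hφ).1

theorem Jg_Sg (D : SSData Xs) [SigmaFinite D.lam] {N a b b' : ℕ} (h : N = a + b)
    (h' : N + 1 = a + b') {φ : (Fin (N + 1) → Xs) → ℝ} (hφ : Integrable φ (D.pim (N + 1))) :
    ∀ᵐ x ∂(D.pim a), D.Jg h' φ x = D.Jg h (D.Sg φ) x := by
  obtain rfl : b' = b + 1 := by omega
  subst h
  filter_upwards [D.Jg_ae h' hφ] with x hx
  unfold Jg
  rw [← (aux_prod (D.mp_snoc b) hx).2.2]
  congr 1
  ext y
  unfold Sg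
  congr 1
  ext z
  congr 1
  ext i
  have := congrFun (Fin.append_snoc x y z) i
  simpa using this

theorem Jg_pos (D : SSData Xs) [SigmaFinite D.lam] (hl : D.lam ≠ 0) {N a b : ℕ} (h : N = a + b)
    {φ : (Fin N → Xs) → ℝ} (hp : ∀ x, 0 < φ x) (hφ : Integrable φ (D.pim N)) :
    ∀ᵐ x ∂(D.pim a), 0 < D.Jg h φ x := by
  filter_upwards [D.Jg_ae h hφ] with x hx
  unfold Jg
  rw [integral_pos_iff_support_of_nonneg (fun y => (hp _).le) hx]
  have : Function.support (fun y : Fin b → Xs => φ (fun i => Fin.append x y (Fin.cast h i)))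
      = Set.univ := by
    ext y; simp [(hp _).ne']
  rw [this, pim, Measure.pi_univ, pos_iff_ne_zero]
  exact Finset.prod_ne_zero_iff.2 fun i _ => by simpa using hl

theorem marg_eq (D : SSData Xs) {t k : ℕ} (h : k ≤ t) (h' : t + 1 = (k + 1) + (t - k))
    (x : Fin (k + 1) → Xs) : D.marg t k x = D.Jg h' (D.post t t) x := by
  rw [marg, dif_pos h]; rfl

theorem condExpF_eq (D : SSData Xs) {t k : ℕ} (h : k ≤ t) (h' : t + 1 = (k + 1) + (t - k))
    (f : (Fin (t + 1) → Xs) → ℝ) (x : Fin (k + 1) → Xs) :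
    D.condExpF t k f x = D.Jg h' (fun z => f z * D.post t t z) x / D.marg t k x := by
  rw [condExpF, dif_pos h, integral_div]; rfl

theorem Jg_self (D : SSData Xs) {N b : ℕ} (hb : b = 0) (h : N = N + b)
    (φ : (Fin N → Xs) → ℝ) (x : Fin N → Xs) : D.Jg h φ x = φ x := by
  subst hb
  unfold Jg pim
  have : ∀ y : Fin 0 → Xs, (fun i : Fin N => Fin.append x y (Fin.cast h i)) = x := by
    intro y; ext i
    exact Fin.append_left x y i
  rw [Measure.pi_of_empty (x := fun i => i.elim0)]
  simp

theorem Vhat_eq (D : SSData Xs) (t : ℕ) (h : (Fin (t + 1) → Xs) → ℝ) :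
    D.Vhat t h = (D.Z t t / D.Z (t + 1) t) ^ 2 * D.V t (fun x => D.aw t x * h x) +
      Vard (D.pim (t + 1)) (D.post (t + 1) t) h := by
  cases t <;> rfl

theorem measurable_gam (D : SSData Xs)
    (hmu0m : ∀ k, Measurable (D.mu0 k)) (hmm : ∀ k, Measurable (Function.uncurry (D.m k)))
    (hgm : ∀ k j, Measurable (D.g k j)) (k s : ℕ) : Measurable (D.gam k s) := by
  unfold gam
  refine Measurable.mul (((hmu0m k).comp (measurable_pi_apply 0)).mul
    ((hgm k 0).comp (measurable_pi_apply 0))) ?_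
  refine Finset.measurable_fun_prod _ fun i _ => ?_
  refine Measurable.mul ?_ ((hgm k _).comp (measurable_pi_apply _))
  have h2 : Measurable (fun a : Fin (s + 1) → Xs => (a i.castSucc, a i.succ)) :=
    (measurable_pi_apply i.castSucc).prodMk (measurable_pi_apply i.succ)
  exact (hmm k).comp h2

end SSData

namespace SSData

variable {Xs : Type} [MeasurableSpace Xs]

theorem cs_aux {μ : Measure Xs} {q u : Xs → ℝ} (hq : ∀ y, 0 < q y) (hq1 : ∫ y, q y ∂μ = 1)
    (h1 : Integrable (fun y => q y * u y) μ) (h2 : Integrable (fun y => q y * u y ^ 2) μ) :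
    (∫ y, q y * u y ∂μ) ^ 2 ≤ ∫ y, q y * u y ^ 2 ∂μ := by
  set c := ∫ y, q y * u y ∂μ with hc
  have hqi : Integrable q μ := by
    by_contra h
    rw [integral_undef h] at hq1
    exact zero_ne_one hq1
  have h0 : 0 ≤ ∫ y, q y * (u y - c) ^ 2 ∂μ :=
    integral_nonneg fun y => mul_nonneg (hq y).le (sq_nonneg _)
  have e : ∀ y, q y * (u y - c) ^ 2 = q y * u y ^ 2 - (2 * c) * (q y * u y) + c ^ 2 * q y := by
    intro y; ring
  simp_rw [e] at h0
  have h3 : Integrable (fun y => q y * u y ^ 2 - (2 * c) * (q y * u y)) μ :=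
    h2.sub (h1.const_mul _)
  rw [integral_add h3 (hqi.const_mul _),
    integral_sub h2 (h1.const_mul _), integral_const_mul, integral_const_mul, ← hc, hq1] at h0
  nlinarith

theorem key_ae (D : SSData Xs) [SigmaFinite D.lam] (hl : D.lam ≠ 0)
    (hpi : ∀ k s, Integrable (D.post k s) (D.pim (s + 1)))
    (hpp : ∀ k s x, 0 < D.post k s x) {t k : ℕ} (hk : k ≤ t) (c m : ℝ)
    (f : (Fin (t + 2) → Xs) → ℝ)
    (hf : Integrable (fun x => f x * D.post (t + 1) (t + 1) x) (D.pim (t + 2)))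
    (g : (Fin (t + 1) → Xs) → ℝ)
    (hg : ∀ x, c * (g x * D.post t t x) =
      D.Sg (fun z => (f z - m) * D.post (t + 1) (t + 1) z) x) :
    ∀ᵐ x ∂(D.pim (k + 1)), c * (D.marg t k x * D.condExpF t k g x) =
      D.marg (t + 1) k x * (D.condExpF (t + 1) k f x - m) := by
  have h : t + 1 = (k + 1) + (t - k) := by omega
  have h' : t + 1 + 1 = (k + 1) + (t + 1 - k) := by omega
  have hφ : Integrable (fun z => (f z - m) * D.post (t + 1) (t + 1) z) (D.pim (t + 1 + 1)) := by
    simp_rw [sub_mul]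
    exact hf.sub ((hpi _ _).const_mul m)
  filter_upwards [D.Jg_Sg h h' hφ, D.Jg_pos hl h (hpp t t) (hpi t t),
    D.Jg_pos hl h' (hpp (t + 1) (t + 1)) (hpi _ _), D.Jg_ae h' hf,
    D.Jg_ae h' (hpi (t + 1) (t + 1))] with x e1 p1 p2 i1 i2
  have hk' : k ≤ t + 1 := by omega
  rw [D.condExpF_eq hk h, D.condExpF_eq hk' h', D.marg_eq hk h, D.marg_eq hk' h',
    mul_div_cancel₀ _ p1.ne', mul_sub, mul_div_cancel₀ _ p2.ne']
  have e2 : c * D.Jg h (fun z => g z * D.post t t z) x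
      = D.Jg h (D.Sg fun z => (f z - m) * D.post (t + 1) (t + 1) z) x := by
    unfold Jg
    rw [← integral_const_mul]
    simp_rw [hg]
  rw [e2, ← e1]
  unfold Jg
  simp_rw [sub_mul]
  rw [integral_sub i1 (i2.const_mul m), integral_const_mul, mul_comm m]

theorem mp_const (D : SSData Xs) [SigmaFinite D.lam] :
    MeasurePreserving (fun x : Xs => (fun _ : Fin 1 => x)) D.lam (D.pim 1) :=
  (measurePreserving_funUnique D.lam (Fin 1)).symm

theorem transfer {α : Type*} [MeasurableSpace α] {μ : Measure α} {c : ℝ} (hc : c ≠ 0)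
    {F G : α → ℝ} (h : ∀ᵐ x ∂μ, c * F x = G x) (hG : Integrable G μ) :
    Integrable F μ ∧ c * ∫ x, F x ∂μ = ∫ x, G x ∂μ := by
  have h1 : Integrable (fun x => c * F x) μ := hG.congr (h.mono fun x hx => hx.symm)
  refine ⟨?_, ?_⟩
  · have := h1.const_mul c⁻¹
    simpa [inv_mul_cancel_left₀ hc] using this
  · rw [← integral_const_mul]
    exact integral_congr_ae h

end SSData

/-- Induction step in the proof of Theorem 2. Suppose that for every
measurable `g : X^{t+1} → ℝ` (with the relevant integrals finite),
`V_t(g) = ∫ (π̄_t^t(x₀))²/q₀(x₀) (G₀(x₀) − m_g)² dλ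
  + Σ_{k=1}^t ∫ (π̄_t^t(x_{0:k}))²/(q_k(x_{0:k-1},x_k) π_k^{k-1}(x_{0:k-1})) (G_k − m_g)² dλ^{⊗(k+1)}`,
with `m_g = E_{π_t^t} g` and `G_k` the conditional expectation of `g` under `π_t^t`. Then for
every measurable `f : X^{t+2} → ℝ` (with the relevant integrals finite), the recursion yields
the same formula for `V_{t+1}(f)` with `t` replaced by `t+1`. -/
theorem semi_online_asymptotic_variance_induction_step
    {Xs : Type} [MeasurableSpace Xs] (D : SSData Xs) [SigmaFinite D.lam]
    (hmu0m : ∀ k, Measurable (D.mu0 k)) (hmm : ∀ k, Measurable (Function.uncurry (D.m k)))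
    (hgm : ∀ k j, Measurable (D.g k j))
    (hmint : ∀ k x, ∫ y, D.m k x y ∂D.lam = 1)
    (hqpos : ∀ j xs y, 0 < D.q j xs y)
    (hqint : ∀ j xs, ∫ y, D.q j xs y ∂D.lam = 1)
    (hZpos : ∀ k s, 0 < D.Z k s)
    (hZfin : ∀ k s, Integrable (D.gam k s) (D.pim (s + 1)))
    (hpostpos : ∀ k s x, 0 < D.post k s x)
    (T : ℕ) (t : ℕ) (htT : t < T)
    (IH : ∀ g : (Fin (t + 1) → Xs) → ℝ, Measurable g →
      Integrable (fun x => g x * D.post t t x) (D.pim (t + 1)) →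
      Integrable (fun x₀ : Xs =>
        (D.marg t 0 (fun _ => x₀)) ^ 2 / D.q 0 (fun i => i.elim0) x₀ *
          (D.condExpF t 0 g (fun _ => x₀) - D.Epost t g) ^ 2) D.lam →
      (∀ j < t, Integrable (fun x : Fin (j + 2) → Xs =>
        (D.marg t (j + 1) x) ^ 2 /
            (D.q (j + 1) (Fin.init x) (x (Fin.last (j + 1))) *
              D.post (j + 1) j (Fin.init x)) *
          (D.condExpF t (j + 1) g x - D.Epost t g) ^ 2) (D.pim (j + 2))) →
      D.V t g =
        (∫ x₀ : Xs, (D.marg t 0 (fun _ => x₀)) ^ 2 / D.q 0 (fun i => i.elim0) x₀ *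
            (D.condExpF t 0 g (fun _ => x₀) - D.Epost t g) ^ 2 ∂D.lam) +
        ∑ j ∈ Finset.range t,
          ∫ x : Fin (j + 2) → Xs, (D.marg t (j + 1) x) ^ 2 /
              (D.q (j + 1) (Fin.init x) (x (Fin.last (j + 1))) *
                D.post (j + 1) j (Fin.init x)) *
            (D.condExpF t (j + 1) g x - D.Epost t g) ^ 2 ∂(D.pim (j + 2)))
    (f : (Fin (t + 2) → Xs) → ℝ) (hfm : Measurable f)
    (hint0 : Integrable (fun x => f x * D.post (t + 1) (t + 1) x) (D.pim (t + 2)))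
    (hint1 : Integrable (fun x₀ : Xs =>
      (D.marg (t + 1) 0 (fun _ => x₀)) ^ 2 / D.q 0 (fun i => i.elim0) x₀ *
        (D.condExpF (t + 1) 0 f (fun _ => x₀) - D.Epost (t + 1) f) ^ 2) D.lam)
    (hint2 : ∀ j < t + 1, Integrable (fun x : Fin (j + 2) → Xs =>
      (D.marg (t + 1) (j + 1) x) ^ 2 /
          (D.q (j + 1) (Fin.init x) (x (Fin.last (j + 1))) *
            D.post (j + 1) j (Fin.init x)) *
        (D.condExpF (t + 1) (j + 1) f x - D.Epost (t + 1) f) ^ 2) (D.pim (j + 2))) :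
    D.V (t + 1) f =
      (∫ x₀ : Xs, (D.marg (t + 1) 0 (fun _ => x₀)) ^ 2 / D.q 0 (fun i => i.elim0) x₀ *
          (D.condExpF (t + 1) 0 f (fun _ => x₀) - D.Epost (t + 1) f) ^ 2 ∂D.lam) +
      ∑ j ∈ Finset.range (t + 1),
        ∫ x : Fin (j + 2) → Xs, (D.marg (t + 1) (j + 1) x) ^ 2 /
            (D.q (j + 1) (Fin.init x) (x (Fin.last (j + 1))) *
              D.post (j + 1) j (Fin.init x)) *
          (D.condExpF (t + 1) (j + 1) f x - D.Epost (t + 1) f) ^ 2 ∂(D.pim (j + 2)) := by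

  have hl : D.lam ≠ 0 := by
    intro h0
    have hX : Nonempty (Fin 0 → Xs) := ⟨fun i => i.elim0⟩
    have := hqint 0 (fun i => i.elim0)
    simp [h0] at this
  have hpi : ∀ k s, Integrable (D.post k s) (D.pim (s + 1)) := fun k s => (hZfin k s).div_const _
  have hp1 : ∀ k s, ∫ x, D.post k s x ∂(D.pim (s + 1)) = 1 := by
    intro k s
    unfold SSData.post
    rw [integral_div]
    exact div_self (hZpos k s).ne'
  have hpm : ∀ k s, Measurable (D.post k s) := fun k s =>
    (D.measurable_gam hmu0m hmm hgm k s).div_const _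
  have hgpos : ∀ k s x, 0 < D.gam k s x := by
    intro k s x
    have := mul_pos (hpostpos k s x) (hZpos k s)
    rwa [SSData.post, div_mul_cancel₀ _ (hZpos k s).ne'] at this
  set m := D.Epost (t + 1) f with hm
  set φ : (Fin (t + 1 + 1) → Xs) → ℝ := fun z => (f z - m) * D.post (t + 1) (t + 1) z with hφdef
  have hφ : Integrable φ (D.pim (t + 1 + 1)) := by
    simp_rw [hφdef, sub_mul]
    exact hint0.sub ((hpi _ _).const_mul m)
  have hφ0 : ∫ z, φ z ∂(D.pim (t + 1 + 1)) = 0 := by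
    simp_rw [hφdef, sub_mul]
    rw [integral_sub hint0 ((hpi _ _).const_mul m), integral_const_mul, hp1, mul_one, hm,
      SSData.Epost, sub_self]
  have hφm : Measurable φ := (hfm.sub_const m).mul (hpm _ _)
  obtain ⟨hS1, hS2, hS3⟩ := SSData.aux_prod (D.mp_snoc (t + 1)) hφ
  have hSm : Measurable (D.Sg φ) := by
    have : StronglyMeasurable (fun p : (Fin (t + 1) → Xs) × Xs =>
        φ (Fin.snoc p.1 p.2 : Fin (t + 1 + 1) → Xs)) :=
      (hφm.comp (D.mp_snoc (t + 1)).measurable).stronglyMeasurable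
    exact this.integral_prod_right'.measurable
  -- the function fed into `Vhat`
  set h : (Fin (t + 1) → Xs) → ℝ := fun x => D.Sg φ x / D.post (t + 1) t x with hh
  set u : (Fin (t + 2) → Xs) → ℝ := fun x => D.vw (t + 1) x * (f x - m) with hu
  have hqu : ∀ xs y, D.q (t + 1) xs y * u (Fin.snoc xs y) =
      φ (Fin.snoc xs y) / D.post (t + 1) t xs := by
    intro xs y
    have h1 := (hqpos (t + 1) xs y).ne'
    have h2 := (hpostpos (t + 1) t xs).ne'
    simp only [hu, hφdef, SSData.vw, Fin.init_snoc, Fin.snoc_last]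
    field_simp
  have hqu1 : (fun xs => ∫ y, D.q (t + 1) xs y * u (Fin.snoc xs y) ∂D.lam) = h := by
    ext xs
    simp_rw [hqu, integral_div]
    rfl
  set c := D.Z t t / D.Z (t + 1) t with hc
  have hc0 : c ≠ 0 := div_ne_zero (hZpos _ _).ne' (hZpos _ _).ne'
  set g : (Fin (t + 1) → Xs) → ℝ := fun x => D.aw t x * h x with hg
  have hgS : ∀ x, c * (g x * D.post t t x) = D.Sg φ x := by
    intro x
    have h1 := (hgpos t t x).ne'
    have h2 := (hgpos (t + 1) t x).ne'
    have h3 := (hZpos t t).ne'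
    have h4 := (hZpos (t + 1) t).ne'
    simp only [hg, hh, hc, SSData.aw, SSData.post]
    field_simp
  have hgm' : Measurable g :=
    ((D.measurable_gam hmu0m hmm hgm _ _).div (D.measurable_gam hmu0m hmm hgm _ _)).mul
      (hSm.div (hpm _ _))
  obtain ⟨hgint, hgI⟩ := SSData.transfer hc0 (Filter.Eventually.of_forall hgS) hS2
  have hEg : D.Epost t g = 0 := by
    have : c * D.Epost t g = 0 := by
      unfold SSData.Epost
      rw [hgI]
      exact hS3.trans hφ0
    exact (mul_eq_zero.1 this).resolve_left hc0
  have hkey := fun (k : ℕ) (hk : k ≤ t) =>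
    D.key_ae hl hpi hpostpos hk c m f hint0 g hgS
  have hsq : ∀ a b a' b' w : ℝ, c * (a * b) = a' * (b' - m) →
      c ^ 2 * (a ^ 2 / w * (b - D.Epost t g) ^ 2) = a' ^ 2 / w * (b' - m) ^ 2 := by
    intro a b a' b' w e
    rw [hEg]
    have : (c * (a * b)) ^ 2 / w = (a' * (b' - m)) ^ 2 / w := by rw [e]
    calc _ = (c * (a * b)) ^ 2 / w := by ring
      _ = _ := by rw [this]; ring
  have hc2 : c ^ 2 ≠ 0 := pow_ne_zero _ hc0
  obtain ⟨a1, b1⟩ := SSData.transfer (μ := D.lam) hc2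
    (F := fun x₀ : Xs => (D.marg t 0 (fun _ => x₀)) ^ 2 / D.q 0 (fun i => i.elim0) x₀ *
          (D.condExpF t 0 g (fun _ => x₀) - D.Epost t g) ^ 2)
    (((D.mp_const).quasiMeasurePreserving.ae (hkey 0 (Nat.zero_le _))).mono
      fun x hx => hsq _ _ _ _ _ hx) hint1
  have hj := fun (j : ℕ) (hj : j < t) => SSData.transfer (μ := D.pim (j + 2)) hc2
    (F := fun x : Fin (j + 2) → Xs => (D.marg t (j + 1) x) ^ 2 /
            (D.q (j + 1) (Fin.init x) (x (Fin.last (j + 1))) *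
              D.post (j + 1) j (Fin.init x)) *
          (D.condExpF t (j + 1) g x - D.Epost t g) ^ 2)
    ((hkey (j + 1) hj).mono fun x hx => hsq _ _ _ _ _ hx) (hint2 j (by omega))
  have hV := IH g hgm' hgint a1 (fun j hj' => (hj j hj').1)
  have hcV : c ^ 2 * D.V t g =
      (∫ x₀ : Xs, (D.marg (t + 1) 0 (fun _ => x₀)) ^ 2 / D.q 0 (fun i => i.elim0) x₀ *
          (D.condExpF (t + 1) 0 f (fun _ => x₀) - m) ^ 2 ∂D.lam) +
      ∑ j ∈ Finset.range t,
        ∫ x : Fin (j + 2) → Xs, (D.marg (t + 1) (j + 1) x) ^ 2 /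
            (D.q (j + 1) (Fin.init x) (x (Fin.last (j + 1))) *
              D.post (j + 1) j (Fin.init x)) *
          (D.condExpF (t + 1) (j + 1) f x - m) ^ 2 ∂(D.pim (j + 2)) := by
    rw [hV, mul_add, b1, Finset.mul_sum]
    congr 1
    exact Finset.sum_congr rfl fun j hj' => (hj j (Finset.mem_range.1 hj')).2
  -- the last term
  have hlast : ∀ x : Fin (t + 2) → Xs, (D.marg (t + 1) (t + 1) x) ^ 2 /
            (D.q (t + 1) (Fin.init x) (x (Fin.last (t + 1))) *
              D.post (t + 1) t (Fin.init x)) *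
          (D.condExpF (t + 1) (t + 1) f x - m) ^ 2 =
        D.post (t + 1) t (Fin.init x) *
          (D.q (t + 1) (Fin.init x) (x (Fin.last (t + 1))) * u x ^ 2) := by
    intro x
    have h' : t + 1 + 1 = (t + 1 + 1) + (t + 1 - (t + 1)) := by omega
    have h0 : t + 1 - (t + 1) = 0 := by omega
    rw [D.condExpF_eq le_rfl h', D.marg_eq le_rfl h', D.Jg_self h0, D.Jg_self h0,
      mul_div_cancel_right₀ _ (hpostpos _ _ _).ne']
    have h1 := (hqpos (t + 1) (Fin.init x) (x (Fin.last (t + 1)))).ne'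
    have h2 := (hpostpos (t + 1) t (Fin.init x)).ne'
    simp only [hu, SSData.vw]
    field_simp
  have hI := hint2 t (Nat.lt_succ_self t)
  simp_rw [hlast] at hI
  obtain ⟨k1, k2, k3⟩ := SSData.aux_prod (D.mp_snoc (t + 1)) hI
  simp only [Fin.init_snoc, Fin.snoc_last] at k1 k2 k3
  have hB : Integrable (fun xs => D.post (t + 1) t xs * h xs ^ 2) (D.pim (t + 1)) := by
    refine k2.mono' ((hpm _ _).mul ((hSm.div (hpm _ _)).pow_const 2)).aestronglyMeasurable ?_
    filter_upwards [k1, hS1] with xs i1 i2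
    have hp := hpostpos (t + 1) t xs
    rw [Real.norm_of_nonneg (mul_nonneg hp.le (sq_nonneg _)), integral_const_mul]
    refine mul_le_mul_of_nonneg_left ?_ hp.le
    rw [← congrFun hqu1 xs]
    refine SSData.cs_aux (hqpos _ _) (hqint _ _) ?_ ?_
    · simp_rw [hqu]
      exact i2.div_const _
    · have := i1.const_mul (D.post (t + 1) t xs)⁻¹
      simpa [inv_mul_cancel_left₀ hp.ne'] using this
  have hmean : ∫ xs, D.post (t + 1) t xs * h xs ∂(D.pim (t + 1)) = 0 := by
    have : ∀ xs, D.post (t + 1) t xs * h xs = D.Sg φ xs := fun xs =>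
      mul_div_cancel₀ _ (hpostpos _ _ _).ne'
    simp_rw [this]
    exact hS3.trans hφ0
  have hvar : ∫ xs, D.post (t + 1) t xs *
      Vard D.lam (fun y => D.q (t + 1) xs y) (fun y => u (Fin.snoc xs y)) ∂(D.pim (t + 1)) =
      (∫ x : Fin (t + 2) → Xs, (D.marg (t + 1) (t + 1) x) ^ 2 /
            (D.q (t + 1) (Fin.init x) (x (Fin.last (t + 1))) *
              D.post (t + 1) t (Fin.init x)) *
          (D.condExpF (t + 1) (t + 1) f x - m) ^ 2 ∂(D.pim (t + 2))) -
      ∫ xs, D.post (t + 1) t xs * h xs ^ 2 ∂(D.pim (t + 1)) := by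
    simp_rw [hlast]
    rw [← k3, ← integral_sub k2 hB]
    congr 1
    ext xs
    rw [Vard, mul_sub, integral_const_mul, ← congrFun hqu1 xs]
  rw [Finset.sum_range_succ, ← add_assoc, ← hcV]
  change D.VtildeStep t (D.Vhat t) u = _
  rw [SSData.VtildeStep, hqu1, SSData.Vhat_eq, hvar, Vard, hmean]
  ring

end
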